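/- Let Γ : ℝ → ℝ³ be a 1-periodic continuous curve, injective on [0,1), let v be an affine line in ℝ³, and let φ ∈ (−π, π] \ {0}. If the rotation Rot(φ, v) maps the image Γ(ℝ) onto itself and Γ(ℝ) ∩ v ≠ ∅, then φ = π. -/

import Mathlib

open MeasureTheory Real Set
open scoped ENNReal NNReal RealInnerProductSpace

/-- Rotation of `ℝ³` by angle `β` about the line through the origin with (unit) direction `u`,
given by Rodrigues' formula
`x ↦ cos β · x + sin β · (u × x) + (1 − cos β)⟨u, x⟩ u`. -/
noncomputable def rotAxisDir (β : ℝ) (u x : EuclideanSpace ℝ (Fin 3)) :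
    EuclideanSpace ℝ (Fin 3) :=
  Real.cos β • x
    + Real.sin β • ((WithLp.equiv 2 (Fin 3 → ℝ)).symm
        (crossProduct (WithLp.equiv 2 (Fin 3 → ℝ) u) (WithLp.equiv 2 (Fin 3 → ℝ) x)))
    + ((1 - Real.cos β) * ⟪u, x⟫) • u

/-- Rotation `Rot(β, ℓ)` of `ℝ³` by angle `β` about the affine line `ℓ = p + ℝu`
(`u` a unit direction): `x ↦ p + R(x − p)` with `R` the rotation by `β` fixing `u`. -/
noncomputable def rotLine (β : ℝ) (p u : EuclideanSpace ℝ (Fin 3))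
    (x : EuclideanSpace ℝ (Fin 3)) : EuclideanSpace ℝ (Fin 3) :=
  p + rotAxisDir β u (x - p)

/-- The action of a `3×3` matrix on `ℝ³` (as a Euclidean space). -/
noncomputable def mulVecE (S : Matrix (Fin 3) (Fin 3) ℝ) (x : EuclideanSpace ℝ (Fin 3)) :
    EuclideanSpace ℝ (Fin 3) :=
  (WithLp.equiv 2 (Fin 3 → ℝ)).symm (S.mulVec (WithLp.equiv 2 (Fin 3 → ℝ) x))

/-- The affine line `p + ℝu` in `ℝ³`. -/
def affLine (p u : EuclideanSpace ℝ (Fin 3)) : Set (EuclideanSpace ℝ (Fin 3)) :=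
  {x | ∃ c : ℝ, x = p + c • u}

/-- A monotone self-map of a bounded set of parameters that is intertwined by a continuous curve
with an isometry fixes every point of the curve. -/
theorem Isometry.eq_self_of_monotoneOn_semiconj {E : Type*} [MetricSpace E] {γ : ℝ → E}
    (hγ : Continuous γ) {S : E → E} (hS : Isometry S) {g : ℝ → ℝ} {a b : ℝ}
    (hmaps : MapsTo g (Ioo a b) (Ioo a b)) (hg : MonotoneOn g (Ioo a b))
    (hsemi : ∀ t ∈ Ioo a b, γ (g t) = S (γ t)) {t : ℝ} (ht : t ∈ Ioo a b) :
    S (γ t) = γ t := by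
  have hmem : ∀ n, g^[n] t ∈ Ioo a b := fun n => hmaps.iterate n ht
  have hstep : ∀ n, γ (g^[n + 1] t) = S (γ (g^[n] t)) := fun n => by
    rw [Function.iterate_succ_apply', hsemi _ (hmem n)]
  obtain ⟨L, hL⟩ : ∃ L, Filter.Tendsto (fun n => g^[n] t) Filter.atTop (nhds L) := by
    rcases le_total t (g t) with h | h
    · refine ⟨_, tendsto_atTop_ciSup (monotone_nat_of_le_succ fun n => ?_)
        ⟨b, by rintro _ ⟨n, rfl⟩; exact (hmem n).2.le⟩⟩
      induction n with
      | zero => simpa using h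
      | succ n ih =>
        rw [Function.iterate_succ_apply' g (n + 1), Function.iterate_succ_apply' g n]
        rw [Function.iterate_succ_apply'] at ih
        exact hg (hmem n) (hmaps (hmem n)) ih
    · refine ⟨_, tendsto_atTop_ciInf (antitone_nat_of_succ_le fun n => ?_)
        ⟨a, by rintro _ ⟨n, rfl⟩; exact (hmem n).1.le⟩⟩
      induction n with
      | zero => simpa using h
      | succ n ih =>
        rw [Function.iterate_succ_apply' g (n + 1), Function.iterate_succ_apply' g n]
        rw [Function.iterate_succ_apply'] at ih
        exact hg (hmaps (hmem n)) (hmem n) ih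
  have hγL : Filter.Tendsto (fun n => γ (g^[n] t)) Filter.atTop (nhds (γ L)) :=
    (hγ.tendsto L).comp hL
  have hfix : S (γ L) = γ L := by
    refine tendsto_nhds_unique ((hS.continuous.tendsto _).comp hγL) ?_
    refine ((Filter.tendsto_add_atTop_iff_nat 1).2 hγL).congr fun n => ?_
    exact hstep n
  have hdist : ∀ n, dist (γ (g^[n] t)) (γ L) = dist (γ t) (γ L) := by
    intro n
    induction n with
    | zero => rfl
    | succ n ih =>
      rw [hstep n, ← ih]
      nth_rewrite 1 [← hfix]
      exact hS.dist_eq _ _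
  have hzero : dist (γ t) (γ L) = 0 := by
    have h1 := tendsto_iff_dist_tendsto_zero.1 hγL
    simp only [hdist] at h1
    exact tendsto_nhds_unique tendsto_const_nhds h1
  rw [dist_eq_zero.1 hzero, hfix]

/-- An isometry that preserves a closed embedded curve and fixes one of its points is an
involution on the curve. -/
theorem Isometry.apply_apply_eq_self_of_closed_curve {E : Type*} [MetricSpace E] {γ : ℝ → E}
    (hγ : Continuous γ) (hper : Function.Periodic γ 1) (hinj : InjOn γ (Ico 0 1))
    {T : E → E} (hT : Isometry T) (hmaps : ∀ t, T (γ t) ∈ range γ) (h0 : T (γ 0) = γ 0)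
    (t : ℝ) : T (T (γ t)) = γ t := by
  have hex : ∀ t, ∃ s ∈ Ico (0 : ℝ) 1, γ s = T (γ t) := by
    intro t
    obtain ⟨s, hs⟩ := hmaps t
    obtain ⟨r, hr, hrs⟩ := hper.exists_mem_Ico₀ one_pos s
    exact ⟨r, hr, by rw [← hrs, hs]⟩
  choose f hfmem hf using hex
  have hzero : (0 : ℝ) ∈ Ico (0 : ℝ) 1 := ⟨le_rfl, one_pos⟩
  have hfmaps : MapsTo f (Ioo 0 1) (Ioo 0 1) := by
    intro t ht
    refine ⟨lt_of_le_of_ne (hfmem t).1 fun h => ?_, (hfmem t).2⟩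
    have h1 : γ t = γ 0 := hT.injective (by rw [← hf t, ← h, h0])
    exact ht.1.ne' (hinj (Ioo_subset_Ico_self ht) hzero h1)
  have hfinj : InjOn f (Ioo 0 1) := by
    intro s hs t ht hst
    refine hinj (Ioo_subset_Ico_self hs) (Ioo_subset_Ico_self ht) (hT.injective ?_)
    rw [← hf s, ← hf t, hst]
  have hfcont : ContinuousOn f (Ioo 0 1) := by
    intro t ht
    refine ContinuousAt.continuousWithinAt ?_
    refine isCompact_Icc.tendsto_nhds_of_unique_mapClusterPt (s := Icc (0 : ℝ) 1)
      (Filter.Eventually.of_forall fun s => Ico_subset_Icc_self (hfmem s)) fun s hs hst => ?_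
    have h1 : MapClusterPt (γ s) (nhds t) (γ ∘ f) := hst.continuousAt_comp hγ.continuousAt
    have h2 : Filter.Tendsto (γ ∘ f) (nhds t) (nhds (T (γ t))) :=
      ((hT.continuous.comp hγ).tendsto t).congr fun s => (hf s).symm
    have h3 : γ s = γ (f t) := by
      rw [hf t]
      exact eq_of_nhds_neBot (h1.neBot.mono (inf_le_inf_left _ h2))
    rcases hs.2.lt_or_eq with hs1 | rfl
    · exact hinj ⟨hs.1, hs1⟩ (hfmem t) h3
    · have h4 : γ 1 = γ 0 := by simpa using hper 0
      exact absurd (hinj hzero (hfmem t) (h4 ▸ h3)) (hfmaps ht).1.ne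
  have hmono : MonotoneOn (f ∘ f) (Ioo 0 1) := by
    rcases hfcont.strictMonoOn_of_injOn_Ioo one_pos hfinj with h | h
    · exact (h.comp h hfmaps).monotoneOn
    · exact (h.comp h hfmaps).monotoneOn
  obtain ⟨s, hs, hst⟩ := hper.exists_mem_Ico₀ one_pos t
  rw [hst]
  rcases hs.1.eq_or_lt with rfl | hs0
  · rw [h0, h0]
  · exact Isometry.eq_self_of_monotoneOn_semiconj hγ (hT.comp hT) (hfmaps.comp hfmaps) hmono
      (fun r _ => by simp [hf]) ⟨hs0, hs.2⟩

/-- A continuous real function of period `1` is not injective on a period. -/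
theorem Function.Periodic.not_injOn_of_continuous {h : ℝ → ℝ} (hper : Function.Periodic h 1)
    (hc : Continuous h) : ¬ InjOn h (Ico 0 1) := by
  intro hinj
  have h1 : h 1 = h 0 := by simpa using hper 0
  have hk : ContinuousOn (fun t => h (t + 1 / 2) - h t) (Icc 0 (1 / 2)) := by fun_prop
  have hz : ∃ t ∈ Icc (0 : ℝ) (1 / 2), h (t + 1 / 2) - h t = 0 := by
    have e : (1 / 2 + 1 / 2 : ℝ) = 1 := by norm_num
    rcases le_total (h (1 / 2)) (h 0) with hle | hle
    · refine intermediate_value_Icc (by norm_num) hk ⟨?_, ?_⟩ <;>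
        simp only [e, h1, zero_add] <;> linarith
    · refine intermediate_value_Icc' (by norm_num) hk ⟨?_, ?_⟩ <;>
        simp only [e, h1, zero_add] <;> linarith
  obtain ⟨t, ht, hzt⟩ := hz
  rcases ht.2.lt_or_eq with hlt | rfl
  · have := hinj ⟨by linarith [ht.1], by linarith⟩ ⟨ht.1, by linarith⟩ (sub_eq_zero.1 hzt)
    linarith
  · have e : (1 / 2 + 1 / 2 : ℝ) = 1 := by norm_num
    rw [e, h1] at hzt
    have := hinj (by norm_num) (by norm_num) (sub_eq_zero.1 hzt)
    norm_num at this

theorem sum_sq_eq_one_of_norm_eq_one {u : EuclideanSpace ℝ (Fin 3)} (hu : ‖u‖ = 1) :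
    u 0 ^ 2 + u 1 ^ 2 + u 2 ^ 2 = 1 := by
  have h := EuclideanSpace.real_norm_sq_eq u
  rw [hu, Fin.sum_univ_three] at h
  linarith

theorem rotAxisDir_apply (β : ℝ) (u x : EuclideanSpace ℝ (Fin 3)) :
    rotAxisDir β u x = !₂[
      cos β * x 0 + sin β * (u 1 * x 2 - u 2 * x 1)
        + (1 - cos β) * (u 0 * x 0 + u 1 * x 1 + u 2 * x 2) * u 0,
      cos β * x 1 + sin β * (u 2 * x 0 - u 0 * x 2)
        + (1 - cos β) * (u 0 * x 0 + u 1 * x 1 + u 2 * x 2) * u 1,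
      cos β * x 2 + sin β * (u 0 * x 1 - u 1 * x 0)
        + (1 - cos β) * (u 0 * x 0 + u 1 * x 1 + u 2 * x 2) * u 2] := by
  ext i
  fin_cases i <;>
    simp [rotAxisDir, crossProduct, PiLp.inner_apply, Fin.sum_univ_three, mul_comm]

theorem rotAxisDir_sub (β : ℝ) (u x y : EuclideanSpace ℝ (Fin 3)) :
    rotAxisDir β u (x - y) = rotAxisDir β u x - rotAxisDir β u y := by
  ext i
  fin_cases i <;> simp [rotAxisDir_apply] <;> ring

theorem norm_rotAxisDir (β : ℝ) {u : EuclideanSpace ℝ (Fin 3)} (hu : ‖u‖ = 1)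
    (x : EuclideanSpace ℝ (Fin 3)) : ‖rotAxisDir β u x‖ = ‖x‖ := by
  have hu' := sum_sq_eq_one_of_norm_eq_one hu
  have hβ := sin_sq_add_cos_sq β
  rw [← sq_eq_sq₀ (norm_nonneg _) (norm_nonneg _), EuclideanSpace.real_norm_sq_eq,
    EuclideanSpace.real_norm_sq_eq, rotAxisDir_apply]
  simp only [Fin.sum_univ_three]
  simp
  linear_combination
    (sin β ^ 2 * (x 0 ^ 2 + x 1 ^ 2 + x 2 ^ 2)
      + (1 - cos β) ^ 2 * (u 0 * x 0 + u 1 * x 1 + u 2 * x 2) ^ 2) * hu'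
    + (x 0 ^ 2 + x 1 ^ 2 + x 2 ^ 2 - (u 0 * x 0 + u 1 * x 1 + u 2 * x 2) ^ 2) * hβ

theorem isometry_rotLine (β : ℝ) (p : EuclideanSpace ℝ (Fin 3))
    {u : EuclideanSpace ℝ (Fin 3)} (hu : ‖u‖ = 1) : Isometry (rotLine β p u) := by
  refine Isometry.of_dist_eq fun x y => ?_
  rw [dist_eq_norm, dist_eq_norm, rotLine, rotLine, add_sub_add_left_eq_sub, ← rotAxisDir_sub,
    norm_rotAxisDir β hu, sub_sub_sub_cancel_right]

theorem rotAxisDir_smul_axis (β c : ℝ) {u : EuclideanSpace ℝ (Fin 3)} (hu : ‖u‖ = 1) :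
    rotAxisDir β u (c • u) = c • u := by
  have hu' := sum_sq_eq_one_of_norm_eq_one hu
  ext i
  fin_cases i
  · simp [rotAxisDir_apply]
    linear_combination (1 - cos β) * c * u 0 * hu'
  · simp [rotAxisDir_apply]
    linear_combination (1 - cos β) * c * u 1 * hu'
  · simp [rotAxisDir_apply]
    linear_combination (1 - cos β) * c * u 2 * hu'

/-- A vector fixed by the square of a rotation that is not an involution lies on the axis. -/
theorem eq_inner_smul_of_rotAxisDir_rotAxisDir_eq {β : ℝ} (hβ : sin β ≠ 0)
    {u : EuclideanSpace ℝ (Fin 3)} (hu : ‖u‖ = 1) {x : EuclideanSpace ℝ (Fin 3)}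
    (hx : rotAxisDir β u (rotAxisDir β u x) = x) : x = ⟪u, x⟫ • u := by
  have hu' := sum_sq_eq_one_of_norm_eq_one hu
  have hcs := sin_sq_add_cos_sq β
  have hd : ⟪u, x⟫ = u 0 * x 0 + u 1 * x 1 + u 2 * x 2 := by
    simp [PiLp.inner_apply, Fin.sum_univ_three, mul_comm]
  rw [hd]
  obtain ⟨d, hd'⟩ : ∃ d, d = u 0 * x 0 + u 1 * x 1 + u 2 * x 2 := ⟨_, rfl⟩
  rw [← hd']
  have e0 : cos β * (u 1 * x 2 - u 2 * x 1) + sin β * (d * u 0 - x 0) = 0 := by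
    have h := congrArg (fun y => y.ofLp 0) hx
    simp [rotAxisDir_apply] at h
    refine (mul_eq_zero.1 ?_).resolve_left (mul_ne_zero two_ne_zero hβ)
    subst hd'
    linear_combination h - (x 0 - (u 0 * x 0 + u 1 * x 1 + u 2 * x 2) * u 0) * hcs
      - (-sin β ^ 2 * x 0 + (1 - cos β) ^ 2 * (u 0 * x 0 + u 1 * x 1 + u 2 * x 2) * u 0) * hu'
  have e1 : cos β * (u 2 * x 0 - u 0 * x 2) + sin β * (d * u 1 - x 1) = 0 := by
    have h := congrArg (fun y => y.ofLp 1) hx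
    simp [rotAxisDir_apply] at h
    refine (mul_eq_zero.1 ?_).resolve_left (mul_ne_zero two_ne_zero hβ)
    subst hd'
    linear_combination h - (x 1 - (u 0 * x 0 + u 1 * x 1 + u 2 * x 2) * u 1) * hcs
      - (-sin β ^ 2 * x 1 + (1 - cos β) ^ 2 * (u 0 * x 0 + u 1 * x 1 + u 2 * x 2) * u 1) * hu'
  have e2 : cos β * (u 0 * x 1 - u 1 * x 0) + sin β * (d * u 2 - x 2) = 0 := by
    have h := congrArg (fun y => y.ofLp 2) hx
    simp [rotAxisDir_apply] at h
    refine (mul_eq_zero.1 ?_).resolve_left (mul_ne_zero two_ne_zero hβ)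
    subst hd'
    linear_combination h - (x 2 - (u 0 * x 0 + u 1 * x 1 + u 2 * x 2) * u 2) * hcs
      - (-sin β ^ 2 * x 2 + (1 - cos β) ^ 2 * (u 0 * x 0 + u 1 * x 1 + u 2 * x 2) * u 2) * hu'
  have hsum : (d * u 0 - x 0) ^ 2 + (d * u 1 - x 1) ^ 2 + (d * u 2 - x 2) ^ 2 = 0 := by
    refine (mul_eq_zero.1 ?_).resolve_left hβ
    linear_combination (d * u 0 - x 0) * e0 + (d * u 1 - x 1) * e1 + (d * u 2 - x 2) * e2
  have n0 := sq_nonneg (d * u 0 - x 0)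
  have n1 := sq_nonneg (d * u 1 - x 1)
  have n2 := sq_nonneg (d * u 2 - x 2)
  have z0 : d * u 0 - x 0 = 0 := pow_eq_zero_iff two_ne_zero |>.1 (by linarith)
  have z1 : d * u 1 - x 1 = 0 := pow_eq_zero_iff two_ne_zero |>.1 (by linarith)
  have z2 : d * u 2 - x 2 = 0 := pow_eq_zero_iff two_ne_zero |>.1 (by linarith)
  ext i
  fin_cases i <;> simp <;> linarith

/-- if a closed embedded curve meets its axis of rotational symmetry, then
the rotational angle `φ ∈ (−π,π] \ {0}` must be `π`. -/
theorem rotation_angle_pi_of_axis_meets_curve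
    (Γ : ℝ → EuclideanSpace ℝ (Fin 3)) (hΓcont : Continuous Γ)
    (hΓper : Function.Periodic Γ 1) (hΓinj : Set.InjOn Γ (Set.Ico 0 1))
    (p u : EuclideanSpace ℝ (Fin 3)) (hu : ‖u‖ = 1)
    (φ : ℝ) (hφ : φ ∈ Set.Ioc (-Real.pi) Real.pi) (hφ0 : φ ≠ 0)
    (hsym : rotLine φ p u '' Set.range Γ = Set.range Γ)
    (hmeet : (Set.range Γ ∩ affLine p u).Nonempty) :
    φ = Real.pi := by
  by_contra hne
  have hsin : sin φ ≠ 0 := by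
    intro h
    rcases lt_or_gt_of_ne hφ0 with hlt | hgt
    · exact (sin_neg_of_neg_of_neg_pi_lt hlt hφ.1).ne h
    · exact (sin_pos_of_pos_of_lt_pi hgt (lt_of_le_of_ne hφ.2 hne)).ne' h
  obtain ⟨_, ⟨t₀, rfl⟩, c, hc⟩ := hmeet
  have hinv : ∀ t, rotLine φ p u (rotLine φ p u (Γ t)) = Γ t := by
    have hper : Function.Periodic (fun t => Γ (t + t₀)) 1 := fun t => by
      simpa [add_right_comm] using hΓper (t + t₀)
    have hinj : InjOn (fun t => Γ (t + t₀)) (Ico 0 1) := by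
      intro s hs t ht hst
      have hfr : ∀ r, Γ (Int.fract r) = Γ r := fun r => by
        simpa using hΓper.sub_zsmul_eq (x := r) ⌊r⌋
      have h1 : Int.fract (s + t₀) = Int.fract (t + t₀) :=
        hΓinj ⟨Int.fract_nonneg _, Int.fract_lt_one _⟩ ⟨Int.fract_nonneg _, Int.fract_lt_one _⟩
          (by rw [hfr, hfr]; exact hst)
      obtain ⟨n, hn⟩ := Int.fract_eq_fract.1 h1
      have hst' : s - t = n := by linarith
      have h2 : Int.fract s = Int.fract t := Int.fract_eq_fract.2 ⟨n, hst'⟩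
      rwa [Int.fract_eq_self.2 hs, Int.fract_eq_self.2 ht] at h2
    intro t
    have h := (isometry_rotLine φ p hu).apply_apply_eq_self_of_closed_curve
      (γ := fun t => Γ (t + t₀)) (by fun_prop) hper hinj (fun t => ?_) ?_ (t - t₀)
    · simpa using h
    · obtain ⟨s, hs⟩ := hsym ▸ mem_image_of_mem (rotLine φ p u) (mem_range_self (t + t₀))
      exact ⟨s - t₀, by simpa using hs⟩
    · simp [hc, rotLine, rotAxisDir_smul_axis φ c hu]
  have haxis : ∀ t, Γ t = p + ⟪u, Γ t - p⟫ • u := fun t => by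
    have h := hinv t
    simp only [rotLine, add_sub_cancel_left] at h
    rw [← eq_inner_smul_of_rotAxisDir_rotAxisDir_eq hsin hu (eq_sub_of_add_eq' h)]
    abel
  refine Function.Periodic.not_injOn_of_continuous (h := fun t => ⟪u, Γ t - p⟫)
    (fun t => by simp [hΓper t]) (by fun_prop) fun s hs t ht hst => hΓinj hs ht ?_
  rw [haxis s, haxis t]
  simp only at hst
  rw [hst]
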